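/- Failure of the global-in-time 1D collapsing estimate (optimality part of Theorem 1.3): For every ε ≥ 0 there is NO constant C such that ( ∫_ℝ ‖ R_ε^{(1)} B_{1,2} U^{(2)}(τ) φ ‖_{L²(ℝ×ℝ)}² dτ )^{1/2} ≤ C ‖ R_ε^{(2)} φ ‖_{L²(ℝ²×ℝ²)} holds for all Schwartz functions φ on ℝ² × ℝ². -/

import Mathlib

open MeasureTheory Complex
open scoped ENNReal NNReal BigOperators

noncomputable section

/-- Euclidean dot product on `Fin k → ℝ`. -/
def dotR {k : ℕ} (a b : Fin k → ℝ) : ℝ := ∑ i, a i * b i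

/-- Japanese bracket `⟨x⟩ = √(1+x²)`. -/
def jap (x : ℝ) : ℝ := Real.sqrt (1 + x ^ 2)

/-- Fourier transform with the convention
`φ̂(ξ,ξ') = ∫ e^{-i(y·ξ + y'·ξ')} φ(y,y') dy dy'`. -/
def ftK (k : ℕ) (φ : (Fin k → ℝ) × (Fin k → ℝ) → ℂ) :
    (Fin k → ℝ) × (Fin k → ℝ) → ℂ :=
  fun ξ => ∫ y : (Fin k → ℝ) × (Fin k → ℝ),
    Complex.exp (-Complex.I * ((dotR y.1 ξ.1 + dotR y.2 ξ.2 : ℝ) : ℂ)) * φ y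

/-- Free evolution `U^{(k)}(τ)`, defined via Fourier inversion: it is the function whose
Fourier transform is `e^{-iτ(|ξ|² - |ξ'|²)} φ̂(ξ,ξ')`. -/
def freeEvol (k : ℕ) (τ : ℝ) (φ : (Fin k → ℝ) × (Fin k → ℝ) → ℂ) :
    (Fin k → ℝ) × (Fin k → ℝ) → ℂ :=
  fun y => (((2 * Real.pi) ^ (2 * k))⁻¹ : ℝ) •
    ∫ ξ : (Fin k → ℝ) × (Fin k → ℝ),
      Complex.exp (Complex.I * ((dotR y.1 ξ.1 + dotR y.2 ξ.2
        - τ * ((∑ i, ξ.1 i ^ 2) - (∑ i, ξ.2 i ^ 2)) : ℝ) : ℂ)) * ftK k φ ξ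

/-- The Fourier multiplier `R_ε^{(k)}` with symbol `∏_j ⟨ξ_j⟩^ε ⟨ξ'_j⟩^ε`. -/
def Rop (ε : ℝ) (k : ℕ) (f : (Fin k → ℝ) × (Fin k → ℝ) → ℂ) :
    (Fin k → ℝ) × (Fin k → ℝ) → ℂ :=
  fun y => (((2 * Real.pi) ^ (2 * k))⁻¹ : ℝ) •
    ∫ ξ : (Fin k → ℝ) × (Fin k → ℝ),
      Complex.exp (Complex.I * ((dotR y.1 ξ.1 + dotR y.2 ξ.2 : ℝ) : ℂ)) *
        (((∏ j, jap (ξ.1 j) ^ ε * jap (ξ.2 j) ^ ε : ℝ) : ℂ) * ftK k f ξ)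

/-- The collision operator `B_{j,k+1}`. -/
def collision (k : ℕ) (j : Fin k) (u : (Fin (k+1) → ℝ) × (Fin (k+1) → ℝ) → ℂ) :
    (Fin k → ℝ) × (Fin k → ℝ) → ℂ :=
  fun y => u (Fin.snoc y.1 (y.1 j), Fin.snoc y.2 (y.1 j))
         - u (Fin.snoc y.1 (y.2 j), Fin.snoc y.2 (y.2 j))

/-- The `L²` norm, valued in `[0,∞]`. -/
def L2E (k : ℕ) (f : (Fin k → ℝ) × (Fin k → ℝ) → ℂ) : ℝ≥0∞ :=
  (∫⁻ y : (Fin k → ℝ) × (Fin k → ℝ), (‖f y‖₊ : ℝ≥0∞) ^ 2) ^ (1/2 : ℝ)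

/-- The phase space `ℝ^k × ℝ^k`. -/
abbrev PS (k : ℕ) : Type := (Fin k → ℝ) × (Fin k → ℝ)

/-- A Euclidean model of the phase space. -/
abbrev EV (k : ℕ) : Type := EuclideanSpace ℝ (Fin k ⊕ Fin k)

instance (k : ℕ) : (volume : Measure (PS k)).HasTemperateGrowth :=
  have : (volume : Measure (PS k)).IsAddHaarMeasure :=
    Measure.prod.instIsAddHaarMeasure (volume : Measure (Fin k → ℝ)) volume
  inferInstance

/-- The inverse of the Fourier transform `ftK`. -/
def invK (k : ℕ) (G : PS k → ℂ) : PS k → ℂ :=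
  fun y => (((2 * Real.pi) ^ (2 * k))⁻¹ : ℝ) •
    ∫ ξ : PS k, Complex.exp (Complex.I * ((dotR y.1 ξ.1 + dotR y.2 ξ.2 : ℝ) : ℂ)) * G ξ

/-- The volume preserving identification of `EV k` with the phase space. -/
def phaseEquiv (k : ℕ) : EV k ≃L[ℝ] PS k :=
  (EuclideanSpace.equiv (Fin k ⊕ Fin k) ℝ).trans
    (ContinuousLinearEquiv.sumPiEquivProdPi ℝ (Fin k) (Fin k) (fun _ => ℝ))

theorem phaseEquiv_measurePreserving (k : ℕ) :
    MeasurePreserving (phaseEquiv k) volume volume :=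
  (volume_measurePreserving_sumPiEquivProdPi (fun _ : Fin k ⊕ Fin k => ℝ)).comp
    (PiLp.volume_preserving_ofLp (Fin k ⊕ Fin k))

/-- The identification of `EV k` with the phase space scaled by `2π`, matching the two Fourier
conventions. -/
def freqEquiv (k : ℕ) : EV k ≃L[ℝ] PS k :=
  (ContinuousLinearEquiv.smulLeft (Units.mk0 (2 * Real.pi) (by positivity))).trans (phaseEquiv k)

theorem freqEquiv_apply (k : ℕ) (x : EV k) :
    freqEquiv k x = (2 * Real.pi) • phaseEquiv k x := by
  rw [← map_smul]; rfl

theorem inner_eq_dotR (k : ℕ) (x ξ : EV k) :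
    2 * Real.pi * inner ℝ x ξ = dotR (phaseEquiv k x).1 (freqEquiv k ξ).1
      + dotR (phaseEquiv k x).2 (freqEquiv k ξ).2 := by
  rw [freqEquiv_apply]
  simp only [PiLp.inner_apply, Fintype.sum_sum_type, dotR, phaseEquiv, Prod.smul_fst,
    Prod.smul_snd, Pi.smul_apply, smul_eq_mul, Finset.mul_sum, mul_add]
  congr 1 <;> refine Finset.sum_congr rfl fun i _ => ?_
  · change 2 * Real.pi * (ξ (Sum.inl i) * x (Sum.inl i)) =
      x (Sum.inl i) * (2 * Real.pi * ξ (Sum.inl i))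
    ring
  · change 2 * Real.pi * (ξ (Sum.inr i) * x (Sum.inr i)) =
      x (Sum.inr i) * (2 * Real.pi * ξ (Sum.inr i))
    ring

theorem integral_comp_phaseEquiv {F : Type*} [NormedAddCommGroup F] [NormedSpace ℝ F] (k : ℕ)
    (f : PS k → F) : ∫ x, f (phaseEquiv k x) = ∫ y, f y :=
  (phaseEquiv_measurePreserving k).integral_comp
    (phaseEquiv k).toHomeomorph.measurableEmbedding f

theorem integral_comp_freqEquiv {F : Type*} [NormedAddCommGroup F] [NormedSpace ℝ F] (k : ℕ)
    (f : PS k → F) : ∫ x, f (freqEquiv k x) = ((2 * Real.pi) ^ (2 * k))⁻¹ • ∫ y, f y := by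
  have h := Measure.integral_comp_smul (volume : Measure (EV k))
    (fun x => f (phaseEquiv k x)) (2 * Real.pi)
  simp only [map_smul, ← freqEquiv_apply] at h
  rw [h, integral_comp_phaseEquiv, finrank_euclideanSpace, Fintype.card_sum, Fintype.card_fin,
    ← two_mul, abs_of_pos (by positivity)]

open SchwartzMap FourierTransform

/-- The Fourier transform `ftK` on Schwartz functions. -/
def ftS (k : ℕ) (φ : 𝓢(PS k, ℂ)) : 𝓢(PS k, ℂ) :=
  compCLMOfContinuousLinearEquiv ℂ (freqEquiv k).symm
    (𝓕 (compCLMOfContinuousLinearEquiv ℂ (phaseEquiv k) φ))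

/-- The inverse Fourier transform `invK` on Schwartz functions. -/
def invS (k : ℕ) (G : 𝓢(PS k, ℂ)) : 𝓢(PS k, ℂ) :=
  compCLMOfContinuousLinearEquiv ℂ (phaseEquiv k).symm
    (𝓕⁻ (compCLMOfContinuousLinearEquiv ℂ (freqEquiv k) G))

theorem ftS_freqEquiv (k : ℕ) (φ : 𝓢(PS k, ℂ)) (ξ : EV k) :
    ftS k φ (freqEquiv k ξ) = 𝓕 (compCLMOfContinuousLinearEquiv ℂ (phaseEquiv k) φ) ξ := by
  simp [ftS]

theorem invS_phaseEquiv (k : ℕ) (φ : 𝓢(PS k, ℂ)) (ξ : EV k) :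
    invS k φ (phaseEquiv k ξ) = 𝓕⁻ (compCLMOfContinuousLinearEquiv ℂ (freqEquiv k) φ) ξ := by
  simp [invS]

theorem ftS_invS (k : ℕ) (G : 𝓢(PS k, ℂ)) : ftS k (invS k G) = G := by
  have : compCLMOfContinuousLinearEquiv ℂ (phaseEquiv k) (invS k G)
      = 𝓕⁻ (compCLMOfContinuousLinearEquiv ℂ (freqEquiv k) G) := by
    ext x; exact invS_phaseEquiv k G x
  rw [ftS, this, fourier_fourierInv_eq]
  ext x; simp

theorem invS_ftS (k : ℕ) (G : 𝓢(PS k, ℂ)) : invS k (ftS k G) = G := by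
  have : compCLMOfContinuousLinearEquiv ℂ (freqEquiv k) (ftS k G)
      = 𝓕 (compCLMOfContinuousLinearEquiv ℂ (phaseEquiv k) G) := by
    ext x; exact ftS_freqEquiv k G x
  rw [invS, this, fourierInv_fourier_eq]
  ext x; simp

theorem coe_ftS (k : ℕ) (φ : 𝓢(PS k, ℂ)) : ⇑(ftS k φ) = ftK k φ := by
  ext ξ
  obtain ⟨ξ, rfl⟩ := (freqEquiv k).surjective ξ
  rw [ftS_freqEquiv, fourier_coe, Real.fourier_eq', ftK, ← integral_comp_phaseEquiv]
  congr 1 with x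
  rw [← inner_eq_dotR]
  simp only [compCLMOfContinuousLinearEquiv_apply, Function.comp, smul_eq_mul]
  congr 2
  push_cast; ring

theorem coe_invS (k : ℕ) (φ : 𝓢(PS k, ℂ)) : ⇑(invS k φ) = invK k φ := by
  ext ξ
  obtain ⟨ξ, rfl⟩ := (phaseEquiv k).surjective ξ
  rw [invS_phaseEquiv, fourierInv_coe, Real.fourierInv_eq', invK, ← integral_comp_freqEquiv]
  congr 1 with x
  rw [← inner_eq_dotR]
  simp only [compCLMOfContinuousLinearEquiv_apply, Function.comp, smul_eq_mul]
  congr 2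
  rw [real_inner_comm]
  push_cast; ring

theorem integral_norm_sq_invS (k : ℕ) (G : 𝓢(PS k, ℂ)) :
    ∫ y, ‖invS k G y‖ ^ 2 = ((2 * Real.pi) ^ (2 * k))⁻¹ * ∫ ξ, ‖G ξ‖ ^ 2 := by
  rw [← integral_comp_phaseEquiv, ← smul_eq_mul, ← integral_comp_freqEquiv]
  simp_rw [invS_phaseEquiv]
  rw [← integral_norm_sq_fourier, fourier_fourierInv_eq]
  rfl

theorem integral_mul_ftS (k : ℕ) (f g : 𝓢(PS k, ℂ)) :
    ∫ ξ, g ξ * ftS k f ξ = ∫ y, f y * ftS k g y := by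
  simp_rw [coe_ftS, ftK, ← integral_const_mul]
  rw [integral_integral_swap]
  · congr 1 with x
    congr 1 with y
    have h : ∀ a b : Fin k → ℝ, dotR a b = dotR b a := fun a b => by simp [dotR, mul_comm]
    rw [h y.1, h y.2]; ring
  · refine ((g.integrable (μ := volume)).norm.mul_prod
      (f.integrable (μ := volume)).norm).mono' ?_ (.of_forall fun x => ?_)
    · refine Continuous.aestronglyMeasurable ?_
      unfold dotR
      have := f.continuous
      have := g.continuous
      simp only [Function.uncurry_def]
      fun_prop
    · simp only [Function.uncurry_def, norm_mul]
      rw [neg_mul, mul_comm I, ← neg_mul, ← Complex.ofReal_neg, Complex.norm_exp_ofReal_mul_I,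
        one_mul]

theorem integrable_norm_sq (k : ℕ) (G : 𝓢(PS k, ℂ)) : Integrable fun x => ‖G x‖ ^ 2 :=
  (G.memLp 2 volume).integrable_norm_pow (by norm_num)

theorem L2E_sq (k : ℕ) (G : 𝓢(PS k, ℂ)) :
    (L2E k (invK k G)) ^ 2 = ENNReal.ofReal (((2 * Real.pi) ^ (2 * k))⁻¹ * ∫ ξ, ‖G ξ‖ ^ 2) := by
  rw [← integral_norm_sq_invS, ofReal_integral_eq_lintegral_ofReal (integrable_norm_sq k _)
    (.of_forall fun _ => by positivity), L2E, ← ENNReal.rpow_natCast, ← ENNReal.rpow_mul]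
  norm_num
  congr 1 with x
  rw [coe_invS]; rfl

/-- The symbol of `Rop`. -/
def weight (ε : ℝ) (k : ℕ) (ξ : PS k) : ℝ := ∏ j, jap (ξ.1 j) ^ ε * jap (ξ.2 j) ^ ε

theorem one_le_jap (x : ℝ) : 1 ≤ jap x := by
  simp only [jap, Real.one_le_sqrt]; nlinarith [sq_nonneg x]

theorem hasTemperateGrowth_weight (ε : ℝ) (k : ℕ) :
    Function.HasTemperateGrowth fun ξ : PS k => (weight ε k ξ : ℂ) := by
  have h : Function.HasTemperateGrowth fun x : ℝ => jap x ^ ε := by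
    have h' : (fun x : ℝ => jap x ^ ε) = fun x => (1 + ‖x‖ ^ 2) ^ (ε / 2) := by
      funext x
      rw [jap, Real.sqrt_eq_rpow, ← Real.rpow_mul (by positivity), Real.norm_eq_abs, sq_abs]
      congr 1
      ring
    rw [h']
    exact Function.hasTemperateGrowth_one_add_norm_sq_rpow ℝ (ε / 2)
  have h1 : ∀ j : Fin k, Function.HasTemperateGrowth fun ξ : PS k => jap (ξ.1 j) ^ ε := fun j =>
    h.comp (((ContinuousLinearMap.proj (R := ℝ) (φ := fun _ : Fin k => ℝ) j).comp
      (ContinuousLinearMap.fst ℝ (Fin k → ℝ) (Fin k → ℝ))).hasTemperateGrowth)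
  have h2 : ∀ j : Fin k, Function.HasTemperateGrowth fun ξ : PS k => jap (ξ.2 j) ^ ε := fun j =>
    h.comp (((ContinuousLinearMap.proj (R := ℝ) (φ := fun _ : Fin k => ℝ) j).comp
      (ContinuousLinearMap.snd ℝ (Fin k → ℝ) (Fin k → ℝ))).hasTemperateGrowth)
  have hw : Function.HasTemperateGrowth fun ξ : PS k => weight ε k ξ := by
    unfold weight
    generalize (Finset.univ : Finset (Fin k)) = s
    induction s using Finset.induction_on with
    | empty => simp
    | insert a s ha ih =>
      simp only [Finset.prod_insert ha]
      exact ((h1 a).mul (h2 a)).mul ih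
  exact Complex.ofRealCLM.hasTemperateGrowth.comp hw

theorem L2E_Rop_sq (ε : ℝ) (k : ℕ) (f : 𝓢(PS k, ℂ)) :
    (L2E k (Rop ε k f)) ^ 2 = ENNReal.ofReal (((2 * Real.pi) ^ (2 * k))⁻¹ *
      ∫ ξ, ‖(weight ε k ξ : ℂ) * ftS k f ξ‖ ^ 2) := by
  have h : ∀ ξ, SchwartzMap.smulLeftCLM ℂ (fun ξ : PS k => (weight ε k ξ : ℂ)) (ftS k f) ξ
      = (weight ε k ξ : ℂ) * ftS k f ξ := fun ξ => by
    rw [SchwartzMap.smulLeftCLM_apply_apply (hasTemperateGrowth_weight ε k), smul_eq_mul]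
  simp_rw [← h, ← L2E_sq]
  congr 2
  ext y
  simp only [invK, h]
  rw [coe_ftS]
  rfl

theorem enorm_integral_mul_sq_le {α : Type*} [MeasurableSpace α] {μ : Measure α} {f g : α → ℂ}
    (hf : AEStronglyMeasurable f μ) (hg : AEStronglyMeasurable g μ) :
    ‖∫ x, f x * g x ∂μ‖ₑ ^ 2 ≤ (∫⁻ x, ‖f x‖ₑ ^ 2 ∂μ) * ∫⁻ x, ‖g x‖ₑ ^ 2 ∂μ := by
  have h := ENNReal.lintegral_mul_le_Lp_mul_Lq μ (p := 2) (q := 2)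
    (by constructor <;> norm_num) hf.enorm hg.enorm
  have h' : ‖∫ x, f x * g x ∂μ‖ₑ ≤ _ :=
    ((enorm_integral_le_lintegral_enorm _).trans_eq (by simp [enorm_mul])).trans h
  refine (pow_le_pow_left' h' 2).trans_eq ?_
  rw [mul_pow, ← ENNReal.rpow_natCast, ← ENNReal.rpow_natCast, ← ENNReal.rpow_mul,
    ← ENNReal.rpow_mul]
  norm_num

theorem lintegral_enorm_sq {α : Type*} [MeasurableSpace α] {μ : Measure α} {f : α → ℂ}
    (hf : Integrable (fun x => ‖f x‖ ^ 2) μ) :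
    ∫⁻ x, ‖f x‖ₑ ^ 2 ∂μ = ENNReal.ofReal (∫ x, ‖f x‖ ^ 2 ∂μ) := by
  rw [ofReal_integral_eq_lintegral_ofReal hf (.of_forall fun _ => by positivity)]
  simp [ENNReal.ofReal_pow]

/-- Restriction of a Schwartz function along an injective linear map. -/
def compInj {k l : ℕ} (L : PS k →L[ℝ] PS l) (hL : Function.Injective L) :
    𝓢(PS l, ℂ) →L[ℂ] 𝓢(PS k, ℂ) :=
  compCLMOfAntilipschitz ℂ L.hasTemperateGrowth
    (L.toLinearMap.exists_antilipschitzWith (LinearMap.ker_eq_bot.2 hL)).choose_spec.2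

theorem compInj_apply {k l : ℕ} (L : PS k →L[ℝ] PS l) (hL : Function.Injective L)
    (u : 𝓢(PS l, ℂ)) (y : PS k) : compInj L hL u y = u (L y) := rfl

theorem integral_mul_ftS_compInj {k l : ℕ} (L : PS k →L[ℝ] PS l) (hL : Function.Injective L)
    (T : PS l → PS k)
    (hLT : ∀ y ξ, dotR (L y).1 ξ.1 + dotR (L y).2 ξ.2 = dotR (T ξ).1 y.1 + dotR (T ξ).2 y.2)
    (H : 𝓢(PS l, ℂ)) (β : 𝓢(PS k, ℂ)) :
    ∫ η, β η * ftS k (compInj L hL (invS l H)) η =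
      (((2 * Real.pi) ^ (2 * l))⁻¹ * (2 * Real.pi) ^ (2 * k) : ℝ) * ∫ ξ, H ξ * β (T ξ) := by
  have hβ : ∀ ξ, β (T ξ) = invK k (ftS k β) (T ξ) := fun ξ => by rw [← coe_invS, invS_ftS]
  simp_rw [hβ]
  rw [integral_mul_ftS]
  simp_rw [compInj_apply, coe_invS, invK, Complex.real_smul, ← integral_const_mul,
    ← integral_mul_const]
  conv_lhs => rw [integral_integral_swap (by
    refine ((((ftS k β).integrable (μ := volume)).norm.mul_prod
      (H.integrable (μ := volume)).norm).const_mul (((2 * Real.pi) ^ (2 * l))⁻¹ : ℝ)).mono' ?_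
      (.of_forall fun x => ?_)
    · refine Continuous.aestronglyMeasurable ?_
      unfold dotR
      have := H.continuous
      have := (ftS k β).continuous
      have := L.continuous
      simp only [Function.uncurry_def]
      fun_prop
    · simp only [Function.uncurry_def, norm_mul]
      rw [mul_comm I, Complex.norm_exp_ofReal_mul_I, Complex.norm_real, Real.norm_of_nonneg
        (by positivity)]
      exact le_of_eq (by ring))]
  congr 1 with ξ
  congr 1 with y
  rw [hLT]
  have : ((2 * Real.pi : ℝ) : ℂ) ≠ 0 := by
    rw [Complex.ofReal_ne_zero]; positivity
  push_cast at this ⊢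
  field_simp

/-- The restriction map of the first collision term. -/
def collisionLeft : PS 1 →L[ℝ] PS 2 :=
  LinearMap.toContinuousLinearMap
    { toFun := fun y => (Fin.snoc y.1 (y.1 0), Fin.snoc y.2 (y.1 0))
      map_add' := fun x y => by
        ext i <;> fin_cases i <;> simp [Fin.snoc]
      map_smul' := fun c y => by
        ext i <;> fin_cases i <;> simp [Fin.snoc] }

/-- The restriction map of the second collision term. -/
def collisionRight : PS 1 →L[ℝ] PS 2 :=
  LinearMap.toContinuousLinearMap
    { toFun := fun y => (Fin.snoc y.1 (y.2 0), Fin.snoc y.2 (y.2 0))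
      map_add' := fun x y => by
        ext i <;> fin_cases i <;> simp [Fin.snoc]
      map_smul' := fun c y => by
        ext i <;> fin_cases i <;> simp [Fin.snoc] }

theorem collisionLeft_apply (y : PS 1) :
    collisionLeft y = (Fin.snoc y.1 (y.1 0), Fin.snoc y.2 (y.1 0)) := rfl

theorem collisionRight_apply (y : PS 1) :
    collisionRight y = (Fin.snoc y.1 (y.2 0), Fin.snoc y.2 (y.2 0)) := rfl

theorem snoc_prod_injective (f : PS 1 → ℝ) : Function.Injective fun y : PS 1 =>
    ((Fin.snoc y.1 (f y), Fin.snoc y.2 (f y)) : PS 2) := by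
  intro x y h
  simp only [Prod.mk.injEq, Fin.snoc_inj] at h
  exact Prod.ext h.1.1 h.2.1

theorem collisionLeft_injective : Function.Injective collisionLeft :=
  snoc_prod_injective fun y => y.1 0

theorem collisionRight_injective : Function.Injective collisionRight :=
  snoc_prod_injective fun y => y.2 0

/-- The transpose of `collisionLeft`. -/
def freqLeft (ξ : PS 2) : PS 1 := (fun _ => ξ.1 0 + ξ.1 1 + ξ.2 1, fun _ => ξ.2 0)

/-- The transpose of `collisionRight`. -/
def freqRight (ξ : PS 2) : PS 1 := (fun _ => ξ.1 0, fun _ => ξ.2 0 + ξ.1 1 + ξ.2 1)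

theorem contDiff_freqLeft : ContDiff ℝ (⊤ : ℕ∞) freqLeft := by unfold freqLeft; fun_prop

theorem contDiff_freqRight : ContDiff ℝ (⊤ : ℕ∞) freqRight := by unfold freqRight; fun_prop

/-- The symbol `|ξ|² - |ξ'|²` of the generator of the free evolution. -/
def disp {k : ℕ} (ξ : PS k) : ℝ := (∑ i, ξ.1 i ^ 2) - ∑ i, ξ.2 i ^ 2

theorem contDiff_disp (k : ℕ) : ContDiff ℝ (⊤ : ℕ∞) (disp (k := k)) := by
  unfold disp; fun_prop

/-- The Schwartz function `e^{iτ(|ξ|² - |ξ'|²)} g(ξ,ξ')` for a smooth compactly supported `g`. -/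
def modS {k : ℕ} (g : PS k → ℝ) (hc : HasCompactSupport g) (hg : ContDiff ℝ (⊤ : ℕ∞) g) (τ : ℝ) :
    𝓢(PS k, ℂ) :=
  HasCompactSupport.toSchwartzMap (f := fun ξ => Complex.exp ((τ * disp ξ : ℝ) * Complex.I) * g ξ)
    ((hc.comp_left (g := fun x : ℝ => (x : ℂ)) Complex.ofReal_zero).mul_left)
    (((Complex.ofRealCLM.contDiff.comp (contDiff_const.mul (contDiff_disp k))).mul
      contDiff_const).cexp.mul (Complex.ofRealCLM.contDiff.comp hg))

theorem modS_apply {k : ℕ} (g : PS k → ℝ) (hc : HasCompactSupport g) (hg : ContDiff ℝ (⊤ : ℕ∞) g)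
    (τ : ℝ) (ξ : PS k) :
    modS g hc hg τ ξ = Complex.exp ((τ * disp ξ : ℝ) * Complex.I) * g ξ := rfl

theorem norm_modS_apply {k : ℕ} (g : PS k → ℝ) (hc : HasCompactSupport g)
    (hg : ContDiff ℝ (⊤ : ℕ∞) g) (τ : ℝ) (ξ : PS k) : ‖modS g hc hg τ ξ‖ = |g ξ| := by
  rw [modS_apply, norm_mul, Complex.norm_exp_ofReal_mul_I, one_mul, Complex.norm_real,
    Real.norm_eq_abs]

theorem freeEvol_invS {k : ℕ} (g : PS k → ℝ) (hc : HasCompactSupport g)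
    (hg : ContDiff ℝ (⊤ : ℕ∞) g) (τ : ℝ) :
    freeEvol k τ (invS k (modS g hc hg 0)) = invS k (modS g hc hg (-τ)) := by
  ext y
  rw [freeEvol, ← coe_ftS, ftS_invS, coe_invS, invK]
  congr 2 with ξ
  rw [modS_apply, modS_apply, ← mul_assoc, ← mul_assoc, ← Complex.exp_add, ← Complex.exp_add]
  congr 2
  rw [disp]
  push_cast
  ring

theorem collision_invS (H : 𝓢(PS 2, ℂ)) :
    collision 1 0 (invS 2 H) = ⇑(compInj collisionLeft collisionLeft_injective (invS 2 H)
      - compInj collisionRight collisionRight_injective (invS 2 H)) := rfl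

theorem ftS_sub (k : ℕ) (f g : 𝓢(PS k, ℂ)) : ftS k (f - g) = ftS k f - ftS k g := by
  simp only [ftS, map_sub, ← FourierTransform.fourierCLM_apply (R := ℂ)]

theorem integral_mul_ftS_collision (H : 𝓢(PS 2, ℂ)) (β : 𝓢(PS 1, ℂ)) :
    ∫ η, β η * ftS 1 (compInj collisionLeft collisionLeft_injective (invS 2 H)
      - compInj collisionRight collisionRight_injective (invS 2 H)) η =
      (((2 * Real.pi) ^ 2)⁻¹ : ℝ) *
        ((∫ ξ, H ξ * β (freqLeft ξ)) - ∫ ξ, H ξ * β (freqRight ξ)) := by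
  have hc : (((2 * Real.pi) ^ (2 * 2))⁻¹ * (2 * Real.pi) ^ (2 * 1) : ℝ)
      = ((2 * Real.pi) ^ 2)⁻¹ := by
    have := Real.pi_pos
    field_simp
    ring
  have hint : ∀ F : 𝓢(PS 1, ℂ), Integrable fun η => β η * ftS 1 F η := fun F =>
    (SchwartzMap.pairing (ContinuousLinearMap.mul ℂ ℂ) β (ftS 1 F)).integrable (μ := volume)
  rw [ftS_sub]
  simp only [_root_.sub_apply, mul_sub]
  rw [integral_sub (hint _) (hint _),
    integral_mul_ftS_compInj _ _ freqLeft,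
    integral_mul_ftS_compInj _ _ freqRight, hc]
  · intro y ξ
    simp [dotR, collisionRight_apply, freqRight, Fin.sum_univ_two, Fin.snoc]
    ring
  · intro y ξ
    simp [dotR, collisionLeft_apply, freqLeft, Fin.sum_univ_two, Fin.snoc]
    ring

theorem integrable_norm_weight_mul_sq (ε : ℝ) (k : ℕ) (f : 𝓢(PS k, ℂ)) :
    Integrable fun ξ => ‖(weight ε k ξ : ℂ) * f ξ‖ ^ 2 := by
  refine (integrable_norm_sq k (SchwartzMap.smulLeftCLM ℂ
    (fun ξ : PS k => (weight ε k ξ : ℂ)) f)).congr (.of_forall fun ξ => ?_)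
  simp only [SchwartzMap.smulLeftCLM_apply_apply (hasTemperateGrowth_weight ε k), smul_eq_mul]

theorem one_le_weight {ε : ℝ} (hε : 0 ≤ ε) (k : ℕ) (ξ : PS k) : 1 ≤ weight ε k ξ :=
  Finset.one_le_prod fun _ _ => one_le_mul_of_one_le_of_one_le
    (Real.one_le_rpow (one_le_jap _) hε) (Real.one_le_rpow (one_le_jap _) hε)

theorem enorm_integral_mul_ftS_sq_le {ε : ℝ} (hε : 0 ≤ ε) (k : ℕ) (β F : 𝓢(PS k, ℂ)) :
    ‖∫ η, β η * ftS k F η‖ₑ ^ 2 ≤ ENNReal.ofReal (∫ η, ‖β η‖ ^ 2) *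
      (ENNReal.ofReal ((2 * Real.pi) ^ (2 * k)) * (L2E k (Rop ε k F)) ^ 2) := by
  refine (enorm_integral_mul_sq_le β.continuous.aestronglyMeasurable
    (ftS k F).continuous.aestronglyMeasurable).trans ?_
  rw [lintegral_enorm_sq (integrable_norm_sq k _), lintegral_enorm_sq (integrable_norm_sq k _),
    L2E_Rop_sq, ← ENNReal.ofReal_mul (p := (2 * Real.pi) ^ (2 * k)) (by positivity),
    mul_inv_cancel_left₀ (by positivity)]
  gcongr ENNReal.ofReal _ * ENNReal.ofReal ?_
  refine integral_mono (integrable_norm_sq k _) (integrable_norm_weight_mul_sq ε k _) fun ξ => ?_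
  have h := one_le_weight hε k ξ
  simp only [norm_mul, Complex.norm_real, Real.norm_eq_abs, mul_pow, sq_abs]
  exact le_mul_of_one_le_left (by positivity) (one_le_pow₀ h)

theorem continuous_oscillatory {X : Type*} [TopologicalSpace X] [MeasurableSpace X]
    [OpensMeasurableSpace X] {μ : Measure X} {p : X → ℝ} (hp : Continuous p) {a : X → ℂ}
    (ha : Integrable a μ) :
    Continuous fun τ : ℝ => ∫ ξ, Complex.exp ((-τ * p ξ : ℝ) * Complex.I) * a ξ ∂μ := by
  refine continuous_of_dominated (bound := fun ξ => ‖a ξ‖) (fun τ => ?_) (fun τ => ?_) ha.norm ?_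
  · exact AEStronglyMeasurable.mul
      (by fun_prop : Measurable fun ξ =>
        Complex.exp ((-τ * p ξ : ℝ) * Complex.I)).aestronglyMeasurable ha.1
  · exact .of_forall fun ξ => by rw [norm_mul, Complex.norm_exp_ofReal_mul_I, one_mul]
  · exact .of_forall fun ξ => by fun_prop

theorem integrable_mul_oscillatory {X : Type*} [TopologicalSpace X] [MeasurableSpace X]
    [OpensMeasurableSpace X] {μ : Measure X} {p : X → ℝ} (hp : Continuous p) {a : X → ℂ}
    (ha : Integrable a μ)
    (θ : 𝓢(ℝ, ℂ)) :
    Integrable fun τ : ℝ => θ τ * ∫ ξ, Complex.exp ((-τ * p ξ : ℝ) * Complex.I) * a ξ ∂μ := by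
  refine θ.integrable.mul_bdd (c := ∫ ξ, ‖a ξ‖ ∂μ)
    (continuous_oscillatory hp ha).aestronglyMeasurable (.of_forall fun τ => ?_)
  refine (norm_integral_le_integral_norm _).trans_eq ?_
  simp only [norm_mul, Complex.norm_exp_ofReal_mul_I, one_mul]

theorem integral_mul_oscillatory {X : Type*} [TopologicalSpace X] [MeasurableSpace X]
    [OpensMeasurableSpace X] {μ : Measure X} [SFinite μ] {p : X → ℝ} (hp : Continuous p)
    {a : X → ℂ} (ha : Integrable a μ) (θ : 𝓢(ℝ, ℂ)) :
    ∫ τ, θ τ * ∫ ξ, Complex.exp ((-τ * p ξ : ℝ) * Complex.I) * a ξ ∂μ =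
      ∫ ξ, 𝓕 θ (p ξ / (2 * Real.pi)) * a ξ ∂μ := by
  simp_rw [fourier_coe, Real.fourier_eq', ← integral_const_mul, ← integral_mul_const]
  rw [integral_integral_swap]
  · congr 1 with ξ
    congr 1 with τ
    have : (Real.pi : ℂ) ≠ 0 := Complex.ofReal_ne_zero.2 Real.pi_ne_zero
    have h : (((-τ * p ξ : ℝ) : ℂ) * I) =
        ((-2 * Real.pi * inner ℝ τ (p ξ / (2 * Real.pi)) : ℝ) : ℂ) * I := by
      congr 2
      simp
      have := Real.pi_ne_zero
      field_simp
    rw [h, smul_eq_mul]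
    ring
  · refine ((θ.integrable (μ := volume)).norm.mul_prod ha.norm).mono' ?_ (.of_forall fun x => ?_)
    · simp only [Function.uncurry_def]
      refine AEStronglyMeasurable.mul ?_ (AEStronglyMeasurable.mul ?_ ?_)
      · exact (θ.continuous.measurable.comp measurable_fst).aestronglyMeasurable
      · have := hp.measurable
        exact (by fun_prop : Measurable fun x : ℝ × X =>
          Complex.exp ((-x.1 * p x.2 : ℝ) * Complex.I)).aestronglyMeasurable
      · exact ha.1.comp_snd
    · simp only [Function.uncurry_def, norm_mul, Complex.norm_exp_ofReal_mul_I, one_mul, le_refl]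

/-- The phase of the first collision term. -/
def phaseLeft (ξ : PS 2) : ℝ := disp ξ - disp (freqLeft ξ)

/-- The phase of the second collision term. -/
def phaseRight (ξ : PS 2) : ℝ := disp ξ - disp (freqRight ξ)

theorem continuous_phaseLeft : Continuous phaseLeft :=
  (contDiff_disp 2).continuous.sub ((contDiff_disp 1).continuous.comp contDiff_freqLeft.continuous)

theorem continuous_phaseRight : Continuous phaseRight :=
  (contDiff_disp 2).continuous.sub ((contDiff_disp 1).continuous.comp contDiff_freqRight.continuous)

theorem modS_mul_modS {G : PS 2 → ℝ} (hcG : HasCompactSupport G) (hG : ContDiff ℝ (⊤ : ℕ∞) G)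
    {b : PS 1 → ℝ} (hcb : HasCompactSupport b) (hb : ContDiff ℝ (⊤ : ℕ∞) b) (τ : ℝ) (ξ : PS 2)
    (η : PS 1) : modS G hcG hG (-τ) ξ * modS b hcb hb τ η =
      Complex.exp ((-τ * (disp ξ - disp η) : ℝ) * Complex.I) * ((G ξ * b η : ℝ) : ℂ) := by
  rw [modS_apply, modS_apply, mul_mul_mul_comm, ← Complex.exp_add]
  push_cast
  ring_nf

theorem sq_integral_le_of_collapsing {ε : ℝ} (hε : 0 ≤ ε) {C : ℝ}
    (h : ∀ φ : SchwartzMap ((Fin 2 → ℝ) × (Fin 2 → ℝ)) ℂ,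
      (∫⁻ τ : ℝ,
          (L2E 1 (Rop ε 1 (collision 1 0 (fun y => freeEvol 2 τ (⇑φ) y)))) ^ 2) ^ (1/2 : ℝ)
        ≤ ENNReal.ofReal C * L2E 2 (Rop ε 2 ⇑φ))
    {G : PS 2 → ℝ} (hcG : HasCompactSupport G) (hG : ContDiff ℝ (⊤ : ℕ∞) G)
    {b : PS 1 → ℝ} (hcb : HasCompactSupport b) (hb : ContDiff ℝ (⊤ : ℕ∞) b)
    {Θ : ℝ → ℝ} (hcΘ : HasCompactSupport Θ) (hΘ : ContDiff ℝ (⊤ : ℕ∞) Θ) :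
    (∫ ξ, G ξ * (Θ (phaseLeft ξ / (2 * Real.pi)) * b (freqLeft ξ) -
      Θ (phaseRight ξ / (2 * Real.pi)) * b (freqRight ξ))) ^ 2 ≤
    ((2 * Real.pi) ^ 2 * (max C 0) ^ 2) * ((∫ x, Θ x ^ 2) * (∫ η, b η ^ 2) *
      ∫ ξ, (weight ε 2 ξ * G ξ) ^ 2) := by
  let F : ℝ → 𝓢(PS 1, ℂ) := fun τ =>
    compInj collisionLeft collisionLeft_injective (invS 2 (modS G hcG hG (-τ)))
      - compInj collisionRight collisionRight_injective (invS 2 (modS G hcG hG (-τ)))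
  let P : ℝ → ℂ := fun τ => ∫ η, modS b hcb hb τ η * ftS 1 (F τ) η
  let aL : PS 2 → ℂ := fun ξ => ((G ξ * b (freqLeft ξ) : ℝ) : ℂ)
  let aR : PS 2 → ℂ := fun ξ => ((G ξ * b (freqRight ξ) : ℝ) : ℂ)
  have haL : Integrable aL := Integrable.ofReal
    (Continuous.integrable_of_hasCompactSupport
      (hG.continuous.mul (hb.continuous.comp contDiff_freqLeft.continuous)) hcG.mul_right)
  have haR : Integrable aR := Integrable.ofReal
    (Continuous.integrable_of_hasCompactSupport
      (hG.continuous.mul (hb.continuous.comp contDiff_freqRight.continuous)) hcG.mul_right)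
  have hP : ∀ τ, P τ = (((2 * Real.pi) ^ 2)⁻¹ : ℝ) *
      ((∫ ξ, Complex.exp ((-τ * phaseLeft ξ : ℝ) * Complex.I) * aL ξ) -
        ∫ ξ, Complex.exp ((-τ * phaseRight ξ : ℝ) * Complex.I) * aR ξ) := fun τ => by
    simp only [P, F]
    rw [integral_mul_ftS_collision]
    simp_rw [modS_mul_modS]
    rfl
  have hPc : Continuous P := by
    simp_rw [funext hP]
    exact continuous_const.mul ((continuous_oscillatory continuous_phaseLeft haL).sub
      (continuous_oscillatory continuous_phaseRight haR))
  let ΘS : 𝓢(ℝ, ℂ) := HasCompactSupport.toSchwartzMap (f := fun x => (Θ x : ℂ))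
    (hcΘ.comp_left (g := fun x : ℝ => (x : ℂ)) Complex.ofReal_zero)
    (Complex.ofRealCLM.contDiff.comp hΘ)
  let θ : 𝓢(ℝ, ℂ) := 𝓕⁻ ΘS
  have hθ : 𝓕 θ = ΘS := fourier_fourierInv_eq ΘS
  have hbdd : ∀ {p : PS 2 → ℝ} {a : PS 2 → ℂ}, Continuous p → Integrable a →
      Integrable fun ξ => ΘS (p ξ / (2 * Real.pi)) * a ξ := fun {p a} hp ha => by
    obtain ⟨c, hc⟩ := hcΘ.exists_bound_of_continuous hΘ.continuous
    refine ha.bdd_mul (c := c)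
      (ΘS.continuous.comp (hp.div_const _)).aestronglyMeasurable (.of_forall fun ξ => ?_)
    exact (Complex.norm_real _).trans_le (hc _)
  have hJ : ∫ τ, θ τ * P τ = (((2 * Real.pi) ^ 2)⁻¹ * ∫ ξ, G ξ * (Θ (phaseLeft ξ / (2 * Real.pi)) *
      b (freqLeft ξ) - Θ (phaseRight ξ / (2 * Real.pi)) * b (freqRight ξ)) : ℝ) := by
    simp_rw [hP, mul_left_comm (θ _), integral_const_mul, mul_sub]
    rw [integral_sub (integrable_mul_oscillatory continuous_phaseLeft haL θ)
      (integrable_mul_oscillatory continuous_phaseRight haR θ),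
      integral_mul_oscillatory continuous_phaseLeft haL,
      integral_mul_oscillatory continuous_phaseRight haR, hθ, ← integral_sub]
    · rw [Complex.ofReal_mul, ← integral_complex_ofReal]
      congr 2 with ξ
      simp only [aL, aR, ΘS]
      push_cast
      show (Θ _ : ℂ) * _ - (Θ _ : ℂ) * _ = _
      ring
    · exact hbdd continuous_phaseLeft haL
    · exact hbdd continuous_phaseRight haR
  have hθ2 : ∫⁻ τ, ‖θ τ‖ₑ ^ 2 = ENNReal.ofReal (∫ x, Θ x ^ 2) := by
    rw [lintegral_enorm_sq ((θ.memLp 2 volume).integrable_norm_pow (by norm_num)),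
      ← integral_norm_sq_fourier, hθ]
    congr 2 with x
    show ‖(Θ x : ℂ)‖ ^ 2 = _
    rw [Complex.norm_real, Real.norm_eq_abs, sq_abs]
  have hb2 : ∀ τ, ∫ η, ‖modS b hcb hb τ η‖ ^ 2 = ∫ η, b η ^ 2 := fun τ => by
    simp_rw [norm_modS_apply, sq_abs]
  have hP2 : ∫⁻ τ, ‖P τ‖ₑ ^ 2 ≤ ENNReal.ofReal (∫ η, b η ^ 2) *
      (ENNReal.ofReal ((2 * Real.pi) ^ 2) * ∫⁻ τ, (L2E 1 (Rop ε 1 (F τ))) ^ 2) := by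
    rw [← lintegral_const_mul' _ _ ENNReal.ofReal_ne_top,
      ← lintegral_const_mul' _ _ ENNReal.ofReal_ne_top]
    refine lintegral_mono fun τ => ?_
    have := enorm_integral_mul_ftS_sq_le hε 1 (modS b hcb hb τ) (F τ)
    rwa [hb2] at this
  have hF : ∫⁻ τ, (L2E 1 (Rop ε 1 (F τ))) ^ 2 ≤ ENNReal.ofReal ((max C 0) ^ 2) *
      ENNReal.ofReal (((2 * Real.pi) ^ (2 * 2))⁻¹ * ∫ ξ, (weight ε 2 ξ * G ξ) ^ 2) := by
    have h1 := pow_le_pow_left' (h (invS 2 (modS G hcG hG 0))) 2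
    rw [mul_pow, L2E_Rop_sq, ftS_invS, ← ENNReal.rpow_natCast, ← ENNReal.rpow_mul] at h1
    simp_rw [freeEvol_invS, norm_mul, norm_modS_apply, Complex.norm_real, Real.norm_eq_abs,
      ← abs_mul, sq_abs] at h1
    rw [ENNReal.ofReal_pow (le_max_right _ _), ENNReal.ofReal_max, ENNReal.ofReal_zero,
      max_eq_left zero_le]
    simp only [F, ← collision_invS]
    simpa using h1
  have hmain := enorm_integral_mul_sq_le (μ := volume) θ.continuous.aestronglyMeasurable
    hPc.aestronglyMeasurable
  rw [hJ, hθ2] at hmain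
  have hfin := hmain.trans (mul_le_mul_right (hP2.trans (mul_le_mul_right
    (mul_le_mul_right hF _) _)) _)
  have n1 : 0 ≤ ∫ x, Θ x ^ 2 := integral_nonneg fun _ => sq_nonneg _
  have n2 : 0 ≤ ∫ η, b η ^ 2 := integral_nonneg fun _ => sq_nonneg _
  have n3 : 0 ≤ ∫ ξ, (weight ε 2 ξ * G ξ) ^ 2 := integral_nonneg fun _ => sq_nonneg _
  rw [← ofReal_norm, ← ENNReal.ofReal_pow (norm_nonneg _), Complex.norm_real,
    Real.norm_eq_abs, sq_abs,
    ← ENNReal.ofReal_mul (p := (max C 0) ^ 2) (by positivity),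
    ← ENNReal.ofReal_mul (p := (2 * Real.pi) ^ 2) (by positivity), ← ENNReal.ofReal_mul n2,
    ← ENNReal.ofReal_mul n1, ENNReal.ofReal_le_ofReal_iff (by positivity), mul_pow] at hfin
  have hpi := Real.pi_pos
  have := mul_le_mul_of_nonneg_left hfin (by positivity : 0 ≤ (2 * Real.pi) ^ 4)
  calc _ = (2 * Real.pi) ^ 4 * _ := ?_
    _ ≤ _ := this
    _ = _ := ?_
  · rw [← mul_assoc, inv_pow, ← pow_mul, mul_inv_cancel₀ (by positivity), one_mul]
  · field_simp
    ring

theorem integral_shear_mul {f₀ f₁ f₂ f₃ : ℝ → ℝ} (h₀ : Integrable f₀) (h₁ : Integrable f₁)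
    (h₂ : Integrable f₂) (h₃ : Integrable f₃) :
    ∫ ξ : PS 2, f₀ (ξ.1 0) * f₁ (ξ.2 0) * f₂ (ξ.1 1 + ξ.2 1) * f₃ (ξ.1 1) =
      (∫ x, f₀ x) * (∫ x, f₁ x) * (∫ x, f₂ x) * ∫ x, f₃ x := by
  let e := (MeasurableEquiv.finTwoArrow (α := ℝ)).prodCongr (MeasurableEquiv.finTwoArrow (α := ℝ))
  have he : MeasurePreserving e :=
    (volume_preserving_finTwoArrow ℝ).prod (volume_preserving_finTwoArrow ℝ)
  have hi : Integrable fun x : (ℝ × ℝ) × ℝ × ℝ =>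
      f₀ x.1.1 * f₁ x.2.1 * f₂ (x.1.2 + x.2.2) * f₃ x.1.2 := by
    have hm : MeasurePreserving fun x : (ℝ × ℝ) × ℝ × ℝ => (x.1, ((0, x.1.2) : ℝ × ℝ) + x.2) :=
      (MeasurePreserving.id volume).skew_product (g := fun x y : ℝ × ℝ => ((0, x.2) : ℝ × ℝ) + y)
        (by fun_prop) (.of_forall fun x => (measurePreserving_add_left volume _).map_eq)
    refine (hm.integrable_comp_of_integrable ((h₀.mul_prod h₃).mul_prod (h₁.mul_prod h₂))).congr
      (.of_forall fun x => ?_)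
    simp only [Function.comp, Prod.fst_add, Prod.snd_add, zero_add]
    ring
  calc _ = ∫ x : (ℝ × ℝ) × ℝ × ℝ, f₀ x.1.1 * f₁ x.2.1 * f₂ (x.1.2 + x.2.2) * f₃ x.1.2 :=
        he.integral_comp' (g := fun x : (ℝ × ℝ) × ℝ × ℝ =>
          f₀ x.1.1 * f₁ x.2.1 * f₂ (x.1.2 + x.2.2) * f₃ x.1.2)
    _ = ∫ x : ℝ × ℝ, ∫ y : ℝ × ℝ, f₀ x.1 * f₁ y.1 * f₂ (x.2 + y.2) * f₃ x.2 := integral_prod _ hi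
    _ = ∫ x : ℝ × ℝ, f₀ x.1 * f₃ x.2 * ((∫ x, f₁ x) * ∫ x, f₂ x) := by
        congr 1 with x
        rw [← integral_add_left_eq_self f₂ x.2, ← integral_prod_mul, ← integral_const_mul]
        congr 1 with y
        ring
    _ = _ := by
        rw [integral_mul_const, Measure.volume_eq_prod, integral_prod_mul]
        ring

theorem integral_phaseOne_mul (f g : ℝ → ℝ) :
    ∫ η : PS 1, f (η.1 0) * g (η.2 0) = (∫ x, f x) * ∫ x, g x := by
  rw [← (volume_preserving_funUnique (Fin 1) ℝ).integral_comp',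
    ← (volume_preserving_funUnique (Fin 1) ℝ).integral_comp', ← integral_prod_mul]
  rfl

/-- A bump function supported in `(1, 2)`. -/
def cutoff : ContDiffBump (3 / 2 : ℝ) := ⟨1 / 4, 1 / 2, by norm_num, by norm_num⟩

/-- A bump function which is `1` on `[-1, 5]`. -/
def plateau : ContDiffBump (2 : ℝ) := ⟨3, 4, by norm_num, by norm_num⟩

/-- A bump function which is `1` on `[-24, 24]` and vanishes off `(-48, 48)`. -/
def window : ContDiffBump (0 : ℝ) := ⟨24, 48, by norm_num, by norm_num⟩

theorem mem_Ioo_of_cutoff_ne_zero {x a : ℝ} (ha : 0 < a) (h : cutoff (x / a) ≠ 0) :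
    a < x ∧ x < 2 * a := by
  have : x / a ∈ Function.support cutoff := h
  rw [cutoff.support_eq, Metric.mem_ball, Real.dist_eq, abs_lt] at this
  have h1 : x / a - 3 / 2 < 1 / 2 := this.2
  have h2 : -(1 / 2) < x / a - 3 / 2 := this.1
  have h3 : 1 < x / a := by linarith
  have h4 : x / a < 2 := by linarith
  exact ⟨(one_lt_div ha).1 h3, (div_lt_iff₀ ha).1 h4⟩

theorem plateau_eq_one {x : ℝ} (h1 : -1 ≤ x) (h2 : x ≤ 5) : plateau x = 1 := by
  refine plateau.one_of_mem_closedBall ?_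
  rw [Metric.mem_closedBall, Real.dist_eq, abs_le]
  simp only [plateau]
  constructor <;> linarith

theorem window_eq_one {x : ℝ} (h : |x| ≤ 24) : window x = 1 := by
  refine window.one_of_mem_closedBall ?_
  rwa [Metric.mem_closedBall, Real.dist_eq, sub_zero]

theorem window_eq_zero {x : ℝ} (h : 48 ≤ x) : window x = 0 := by
  refine window.zero_of_le_dist ?_
  rw [Real.dist_eq, sub_zero]
  exact h.trans (le_abs_self x)

/-- A bump at frequencies `ξ₁ ~ δ`, `ξ₁' ~ 1`, `ξ₂ + ξ₂' ~ σ`, `ξ₂ ~ ρ`. -/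
def cell (δ σ ρ : ℝ) (ξ : PS 2) : ℝ :=
  cutoff (ξ.1 0 / δ) * cutoff (ξ.2 0 / 1) * cutoff ((ξ.1 1 + ξ.2 1) / σ) * cutoff (ξ.1 1 / ρ)

theorem contDiff_cell (δ σ ρ : ℝ) : ContDiff ℝ (⊤ : ℕ∞) (cell δ σ ρ) := by
  have h : ContDiff ℝ (⊤ : ℕ∞) cutoff := cutoff.contDiff
  unfold cell
  refine ((ContDiff.mul ?_ ?_).mul ?_).mul ?_ <;> exact h.comp (by fun_prop)

theorem cell_nonneg (δ σ ρ : ℝ) (ξ : PS 2) : 0 ≤ cell δ σ ρ ξ := by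
  unfold cell
  have := cutoff.nonneg (x := ξ.1 0 / δ)
  have := cutoff.nonneg (x := ξ.2 0 / 1)
  have := cutoff.nonneg (x := (ξ.1 1 + ξ.2 1) / σ)
  have := cutoff.nonneg (x := ξ.1 1 / ρ)
  positivity

theorem integrable_cutoff_div {a : ℝ} (ha : 0 < a) : Integrable fun x => cutoff (x / a) :=
  (cutoff.continuous.integrable_of_hasCompactSupport cutoff.hasCompactSupport).comp_div ha.ne'

theorem integral_cutoff_div {a : ℝ} (ha : 0 < a) :
    ∫ x, cutoff (x / a) = a * ∫ x, cutoff x := by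
  rw [Measure.integral_comp_div, abs_of_pos ha, smul_eq_mul]

theorem integral_cell {δ σ ρ : ℝ} (hδ : 0 < δ) (hσ : 0 < σ) (hρ : 0 < ρ) :
    ∫ ξ, cell δ σ ρ ξ = δ * (σ * ρ) * (∫ x, cutoff x) ^ 4 := by
  unfold cell
  rw [integral_shear_mul (integrable_cutoff_div hδ) (integrable_cutoff_div one_pos)
    (integrable_cutoff_div hσ) (integrable_cutoff_div hρ), integral_cutoff_div hδ,
    integral_cutoff_div one_pos, integral_cutoff_div hσ, integral_cutoff_div hρ]
  ring

theorem bounds_of_cell_ne_zero {δ σ ρ : ℝ} (hδ : 0 < δ) (hσ : 0 < σ) (hρ : 0 < ρ) {ξ : PS 2}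
    (h : cell δ σ ρ ξ ≠ 0) : (δ < ξ.1 0 ∧ ξ.1 0 < 2 * δ) ∧ (1 < ξ.2 0 ∧ ξ.2 0 < 2) ∧
      (σ < ξ.1 1 + ξ.2 1 ∧ ξ.1 1 + ξ.2 1 < 2 * σ) ∧ ρ < ξ.1 1 ∧ ξ.1 1 < 2 * ρ := by
  simp only [cell, mul_ne_zero_iff] at h
  obtain ⟨⟨⟨h0, h1⟩, h2⟩, h3⟩ := h
  have := mem_Ioo_of_cutoff_ne_zero one_pos h1
  rw [mul_one] at this
  exact ⟨mem_Ioo_of_cutoff_ne_zero hδ h0, this, mem_Ioo_of_cutoff_ne_zero hσ h2,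
    mem_Ioo_of_cutoff_ne_zero hρ h3⟩

theorem phaseLeft_eq (ξ : PS 2) :
    phaseLeft ξ = 2 * (ξ.1 1 + ξ.2 1) * (ξ.1 1 - ξ.1 0 - (ξ.1 1 + ξ.2 1)) := by
  simp [phaseLeft, disp, freqLeft, Fin.sum_univ_two]
  ring

theorem phaseRight_eq (ξ : PS 2) :
    phaseRight ξ = 2 * (ξ.1 1 + ξ.2 1) * (ξ.1 1 + ξ.2 0) := by
  simp [phaseRight, disp, freqRight, Fin.sum_univ_two]
  ring

theorem norm_le_of_cell_ne_zero {δ σ ρ : ℝ} (hδ : 0 < δ) (hσ : 0 < σ) (hρ : 0 < ρ) (hδ1 : δ ≤ 1)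
    (hσ1 : σ ≤ 1) (hρ1 : ρ ≤ 1) {ξ : PS 2} (h : cell δ σ ρ ξ ≠ 0) : ‖ξ‖ ≤ 3 := by
  obtain ⟨⟨h0, h0'⟩, ⟨h1, h1'⟩, ⟨h2, h2'⟩, h3, h3'⟩ := bounds_of_cell_ne_zero hδ hσ hρ h
  rw [Prod.norm_def, max_le_iff, pi_norm_le_iff_of_nonneg (by norm_num),
    pi_norm_le_iff_of_nonneg (by norm_num)]
  simp only [Fin.forall_fin_two, Real.norm_eq_abs, abs_le]
  refine ⟨⟨⟨?_, ?_⟩, ?_, ?_⟩, ⟨?_, ?_⟩, ?_, ?_⟩ <;> linarith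

/-- On a cell the first collision term is resonant and the second one is not. -/
theorem cell_mul_eq {δ σ ρ : ℝ} (hδ : 0 < δ) (hρ : 0 < ρ) (hσρ : σ * ρ = δ ^ 2)
    (hσ1 : 256 * δ ^ 2 ≤ σ) (hσ2 : σ ≤ δ) (ξ : PS 2) :
    cell δ σ ρ ξ * (window (phaseLeft ξ / (2 * Real.pi) / δ ^ 2) *
      (plateau ((freqLeft ξ).1 0 / δ) * plateau ((freqLeft ξ).2 0)) -
      window (phaseRight ξ / (2 * Real.pi) / δ ^ 2) *
        (plateau ((freqRight ξ).1 0 / δ) * plateau ((freqRight ξ).2 0))) = cell δ σ ρ ξ := by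
  by_cases h : cell δ σ ρ ξ = 0
  · rw [h, zero_mul]
  have hσ : 0 < σ := lt_of_lt_of_le (by positivity) hσ1
  obtain ⟨⟨h0, h0'⟩, ⟨h1, h1'⟩, ⟨h2, h2'⟩, h3, h3'⟩ := bounds_of_cell_ne_zero hδ hσ hρ h
  have hpi := Real.pi_gt_three
  have hpi' := Real.pi_lt_four
  set s := ξ.1 1 + ξ.2 1 with hs
  have hs0 : 0 < s := hσ.trans h2
  have hx0 : 0 < ξ.1 0 := hδ.trans h0
  have hv0 : 0 < ξ.1 1 := hρ.trans h3
  have e1 : window (phaseLeft ξ / (2 * Real.pi) / δ ^ 2) = 1 := by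
    refine window_eq_one ?_
    rw [abs_div, abs_div, abs_of_pos (a := 2 * Real.pi) (by positivity),
      abs_of_pos (a := δ ^ 2) (by positivity), div_le_iff₀ (by positivity),
      div_le_iff₀ (by positivity), phaseLeft_eq, ← hs, abs_le]
    have k1 : s * ξ.1 1 ≤ (2 * σ) * (2 * ρ) := by gcongr
    have k2 : s * ξ.1 0 ≤ (2 * δ) * (2 * δ) := by gcongr; linarith
    have k3 : s * s ≤ (2 * δ) * (2 * δ) := by gcongr <;> linarith
    have l1 : 0 ≤ s * ξ.1 1 := by positivity
    have l2 : 0 ≤ s * ξ.1 0 := by positivity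
    have l3 : 0 ≤ s * s := by positivity
    have l4 : 24 * δ ^ 2 * (2 * 3) ≤ 24 * δ ^ 2 * (2 * Real.pi) := by gcongr
    constructor <;> nlinarith
  have e2 : window (phaseRight ξ / (2 * Real.pi) / δ ^ 2) = 0 := by
    refine window_eq_zero ?_
    rw [le_div_iff₀ (by positivity), le_div_iff₀ (by positivity), phaseRight_eq, ← hs]
    have l4 : 48 * δ ^ 2 * (2 * Real.pi) ≤ 48 * δ ^ 2 * (2 * 4) := by gcongr
    have k1 : σ * 1 ≤ s * (ξ.1 1 + ξ.2 0) := by gcongr; linarith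
    nlinarith
  have e3 : plateau ((freqLeft ξ).1 0 / δ) = 1 := by
    have : (freqLeft ξ).1 0 = ξ.1 0 + s := by simp [freqLeft, hs, add_assoc]
    rw [this]
    refine plateau_eq_one ?_ ?_
    · rw [le_div_iff₀ hδ]; linarith
    · rw [div_le_iff₀ hδ]; linarith
  have e4 : plateau ((freqLeft ξ).2 0) = 1 :=
    plateau_eq_one (by simp only [freqLeft]; linarith) (by simp only [freqLeft]; linarith)
  rw [e1, e2, e3, e4]
  ring

theorem cell_le_one (δ σ ρ : ℝ) (ξ : PS 2) : cell δ σ ρ ξ ≤ 1 := by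
  have h : ∀ x, cutoff x ≤ 1 := fun _ => cutoff.le_one
  have h' : ∀ x, 0 ≤ cutoff x := fun _ => cutoff.nonneg
  unfold cell
  exact mul_le_one₀ (mul_le_one₀ (mul_le_one₀ (h _) (h' _) (h _)) (h' _) (h _)) (h' _) (h _)

/-- Superposition of `n` cells with dyadic total frequencies between `δ²` and `δ ≈ 2⁻ⁿ`. -/
def cellSum (n : ℕ) (ξ : PS 2) : ℝ :=
  ∑ j ∈ Finset.range n, cell (1 / (256 * 2 ^ n)) (256 * (1 / (256 * 2 ^ n)) ^ 2 * 2 ^ j)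
    (1 / (256 * 2 ^ j)) ξ

theorem norm_le_of_cellSum_ne_zero {n : ℕ} {ξ : PS 2} (h : cellSum n ξ ≠ 0) : ‖ξ‖ ≤ 3 := by
  obtain ⟨j, hj, hne⟩ := Finset.exists_ne_zero_of_sum_ne_zero h
  have hjn : (2 : ℝ) ^ j ≤ 2 ^ n :=
    pow_le_pow_right₀ (by norm_num) (Finset.mem_range.1 hj).le
  have h1 : (1 : ℝ) ≤ 2 ^ n := one_le_pow₀ (by norm_num)
  have h2 : (1 : ℝ) ≤ 2 ^ j := one_le_pow₀ (by norm_num)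
  refine norm_le_of_cell_ne_zero (by positivity) (by positivity) (by positivity) ?_ ?_ ?_ hne
  · rw [div_le_one (by positivity)]; linarith
  · calc _ ≤ 256 * (1 / (256 * 2 ^ n)) ^ 2 * (2 : ℝ) ^ n := by gcongr
      _ = 1 / (256 * 2 ^ n) := by field_simp
      _ ≤ 1 := by rw [div_le_one (by positivity)]; linarith
  · rw [div_le_one (by positivity)]; linarith

theorem contDiff_cellSum (n : ℕ) : ContDiff ℝ (⊤ : ℕ∞) (cellSum n) :=
  ContDiff.sum fun _ _ => contDiff_cell _ _ _

theorem hasCompactSupport_cellSum (n : ℕ) : HasCompactSupport (cellSum n) :=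
  HasCompactSupport.of_support_subset_isCompact (isCompact_closedBall 0 3) fun _ h =>
    mem_closedBall_zero_iff.2 (norm_le_of_cellSum_ne_zero h)

theorem integral_cellSum (n : ℕ) :
    ∫ ξ, cellSum n ξ = n * (1 / (256 * 2 ^ n)) ^ 3 * (∫ x, cutoff x) ^ 4 := by
  have h : ∀ j, ∫ ξ, cell (1 / (256 * 2 ^ n)) (256 * (1 / (256 * 2 ^ n)) ^ 2 * 2 ^ j)
      (1 / (256 * 2 ^ j)) ξ = (1 / (256 * 2 ^ n)) ^ 3 * (∫ x, cutoff x) ^ 4 := fun j => by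
    rw [integral_cell (by positivity) (by positivity) (by positivity)]
    field_simp
  have hκ : 0 < ∫ x, cutoff x := cutoff.integral_pos
  unfold cellSum
  rw [integral_finsetSum _ fun j _ => .of_integral_ne_zero (by rw [h]; positivity)]
  simp only [h, Finset.sum_const, Finset.card_range, nsmul_eq_mul]
  rw [mul_assoc]

theorem cellSum_nonneg (n : ℕ) (ξ : PS 2) : 0 ≤ cellSum n ξ :=
  Finset.sum_nonneg fun _ _ => cell_nonneg _ _ _ _

theorem cellSum_le_one (n : ℕ) (ξ : PS 2) : cellSum n ξ ≤ 1 := by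
  by_cases h : cellSum n ξ = 0
  · rw [h]; exact zero_le_one
  obtain ⟨j, hj, hne⟩ := Finset.exists_ne_zero_of_sum_ne_zero h
  rw [cellSum, Finset.sum_eq_single_of_mem j hj fun i _ hij => ?_]
  · exact cell_le_one _ _ _ _
  by_contra hi
  set c : ℝ := 256 * (1 / (256 * 2 ^ n)) ^ 2
  have hc : 0 < c := by positivity
  obtain ⟨-, -, ⟨a1, a2⟩, -⟩ :=
    bounds_of_cell_ne_zero (by positivity) (by positivity) (by positivity) hne
  obtain ⟨-, -, ⟨b1, b2⟩, -⟩ :=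
    bounds_of_cell_ne_zero (by positivity) (by positivity) (by positivity) hi
  rcases hij.lt_or_gt with hlt | hlt
  · have : c * (2 ^ (i + 1)) ≤ c * 2 ^ j := by gcongr; exacts [one_le_two, hlt]
    rw [pow_succ] at this
    linarith
  · have : c * (2 ^ (j + 1)) ≤ c * 2 ^ i := by gcongr; exacts [one_le_two, hlt]
    rw [pow_succ] at this
    linarith

theorem cellSum_mul_eq (n : ℕ) (ξ : PS 2) :
    cellSum n ξ * (window (phaseLeft ξ / (2 * Real.pi) / (1 / (256 * 2 ^ n)) ^ 2) *
      (plateau ((freqLeft ξ).1 0 / (1 / (256 * 2 ^ n))) * plateau ((freqLeft ξ).2 0)) -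
      window (phaseRight ξ / (2 * Real.pi) / (1 / (256 * 2 ^ n)) ^ 2) *
        (plateau ((freqRight ξ).1 0 / (1 / (256 * 2 ^ n))) * plateau ((freqRight ξ).2 0))) =
      cellSum n ξ := by
  unfold cellSum
  rw [Finset.sum_mul]
  refine Finset.sum_congr rfl fun j hj => ?_
  refine cell_mul_eq (by positivity) (by positivity) ?_ ?_ ?_ ξ
  · field_simp
  · exact le_mul_of_one_le_right (by positivity) (one_le_pow₀ one_le_two)
  · calc _ ≤ 256 * (1 / (256 * 2 ^ n)) ^ 2 * (2 : ℝ) ^ n := by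
          gcongr
          exacts [one_le_two, (Finset.mem_range.1 hj).le]
      _ = 1 / (256 * 2 ^ n) := by field_simp

theorem exists_weight_le (ε : ℝ) : ∃ W : ℝ, ∀ ξ : PS 2, ‖ξ‖ ≤ 3 → |weight ε 2 ξ| ≤ W := by
  obtain ⟨W, hW⟩ := (isCompact_closedBall (0 : PS 2) 3).exists_bound_of_continuousOn
    (hasTemperateGrowth_weight ε 2).1.continuous.continuousOn
  refine ⟨W, fun ξ hξ => ?_⟩
  have := hW ξ (mem_closedBall_zero_iff.2 hξ)
  rwa [Complex.norm_real] at this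

theorem integral_weight_mul_cellSum_sq_le {ε W : ℝ}
    (hW : ∀ ξ : PS 2, ‖ξ‖ ≤ 3 → |weight ε 2 ξ| ≤ W) (n : ℕ) :
    ∫ ξ, (weight ε 2 ξ * cellSum n ξ) ^ 2 ≤ W ^ 2 * ∫ ξ, cellSum n ξ := by
  rw [← integral_const_mul]
  have hi : Integrable (cellSum n) :=
    (contDiff_cellSum n).continuous.integrable_of_hasCompactSupport (hasCompactSupport_cellSum n)
  refine integral_mono_of_nonneg (.of_forall fun _ => sq_nonneg _) (hi.const_mul _)
    (.of_forall fun ξ => ?_)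
  by_cases h : cellSum n ξ = 0
  · simp [h]
  have h0 := cellSum_nonneg n ξ
  have h1 := cellSum_le_one n ξ
  simp only [mul_pow]
  have := sq_le_sq' (neg_le_of_abs_le (hW ξ (norm_le_of_cellSum_ne_zero h)))
    (le_of_abs_le (hW ξ (norm_le_of_cellSum_ne_zero h)))
  gcongr
  nlinarith

theorem HasCompactSupport.mul_phaseOne {f g : ℝ → ℝ} (hf : HasCompactSupport f)
    (hg : HasCompactSupport g) : HasCompactSupport fun η : PS 1 => f (η.1 0) * g (η.2 0) := by
  refine HasCompactSupport.of_support_subset_isCompact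
    ((isCompact_univ_pi fun _ => hf).prod (isCompact_univ_pi fun _ => hg)) fun η hη => ?_
  rw [Function.mem_support, mul_ne_zero_iff] at hη
  refine ⟨fun i _ => ?_, fun i _ => ?_⟩
  · rw [Subsingleton.elim i 0]; exact subset_tsupport _ hη.1
  · rw [Subsingleton.elim i 0]; exact subset_tsupport _ hη.2

theorem HasCompactSupport.comp_div {f : ℝ → ℝ} (hf : HasCompactSupport f) {a : ℝ} (ha : a ≠ 0) :
    HasCompactSupport fun x => f (x / a) := by
  simpa [div_eq_inv_mul] using hf.comp_smul (inv_ne_zero ha)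

theorem integral_sq_comp_div (f : ℝ → ℝ) {a : ℝ} (ha : 0 < a) :
    ∫ x, f (x / a) ^ 2 = a * ∫ x, f x ^ 2 := by
  rw [Measure.integral_comp_div (fun x => f x ^ 2), abs_of_pos ha, smul_eq_mul]

theorem integral_cellSum_le_of_collapsing {ε : ℝ} (hε : 0 ≤ ε) {C : ℝ}
    (h : ∀ φ : SchwartzMap ((Fin 2 → ℝ) × (Fin 2 → ℝ)) ℂ,
      (∫⁻ τ : ℝ,
          (L2E 1 (Rop ε 1 (collision 1 0 (fun y => freeEvol 2 τ (⇑φ) y)))) ^ 2) ^ (1/2 : ℝ)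
        ≤ ENNReal.ofReal C * L2E 2 (Rop ε 2 ⇑φ))
    {W : ℝ} (hW : ∀ ξ : PS 2, ‖ξ‖ ≤ 3 → |weight ε 2 ξ| ≤ W) (n : ℕ) :
    (∫ ξ, cellSum n ξ) ^ 2 ≤ (1 / (256 * 2 ^ n)) ^ 3 *
      (((2 * Real.pi) ^ 2 * (max C 0) ^ 2) *
        ((∫ x, window x ^ 2) * (∫ x, plateau x ^ 2) ^ 2 * W ^ 2)) * ∫ ξ, cellSum n ξ := by
  have hG := integral_weight_mul_cellSum_sq_le hW n
  have hδ : (0 : ℝ) < 1 / (256 * 2 ^ n) := by positivity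
  have hmul := cellSum_mul_eq n
  generalize (1 / (256 * 2 ^ n) : ℝ) = δ at hδ hmul ⊢
  have hw : ContDiff ℝ (⊤ : ℕ∞) window := window.contDiff
  have hp : ContDiff ℝ (⊤ : ℕ∞) plateau := plateau.contDiff
  have key := sq_integral_le_of_collapsing hε h (hasCompactSupport_cellSum n) (contDiff_cellSum n)
    (b := fun η => plateau (η.1 0 / δ) * plateau (η.2 0))
    ((plateau.hasCompactSupport.comp_div hδ.ne').mul_phaseOne plateau.hasCompactSupport)
    ((hp.comp (by fun_prop)).mul (hp.comp (by fun_prop)))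
    (window.hasCompactSupport.comp_div (pow_pos hδ 2).ne') (hw.comp (by fun_prop))
  have hb : ∫ η : PS 1, (plateau (η.1 0 / δ) * plateau (η.2 0)) ^ 2 =
      δ * (∫ x, plateau x ^ 2) ^ 2 := by
    simp_rw [mul_pow]
    rw [integral_phaseOne_mul (fun x => plateau (x / δ) ^ 2) (fun x => plateau x ^ 2),
      integral_sq_comp_div _ hδ]
    ring
  simp_rw [hmul] at key
  rw [integral_sq_comp_div _ (pow_pos hδ 2), hb] at key
  have hw0 : 0 ≤ ∫ x, window x ^ 2 := integral_nonneg fun _ => sq_nonneg _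
  calc _ ≤ _ := key
    _ ≤ ((2 * Real.pi) ^ 2 * (max C 0) ^ 2) * ((δ ^ 2 * ∫ x, window x ^ 2) *
      (δ * (∫ x, plateau x ^ 2) ^ 2) * (W ^ 2 * ∫ ξ, cellSum n ξ)) := by gcongr
    _ = _ := by ring

/-- **Failure of the global-in-time 1D collapsing estimate** (optimality part of Theorem 1.3):
for every `ε ≥ 0` there is no constant `C` such that
`(∫_ℝ ‖R_ε^{(1)} B_{1,2} U^{(2)}(τ) φ‖_{L²}² dτ)^{1/2} ≤ C ‖R_ε^{(2)} φ‖_{L²}`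
holds for all Schwartz `φ`. -/
theorem no_global_in_time_collapsing (ε : ℝ) (hε : 0 ≤ ε) :
    ¬ ∃ C : ℝ, ∀ φ : SchwartzMap ((Fin 2 → ℝ) × (Fin 2 → ℝ)) ℂ,
      (∫⁻ τ : ℝ,
          (L2E 1 (Rop ε 1 (collision 1 0 (fun y => freeEvol 2 τ (⇑φ) y)))) ^ 2) ^ (1/2 : ℝ)
        ≤ ENNReal.ofReal C * L2E 2 (Rop ε 2 ⇑φ) := by
  rintro ⟨C, hC⟩
  obtain ⟨W, hW⟩ := exists_weight_le ε
  have hκ : 0 < ∫ x, cutoff x := cutoff.integral_pos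
  have hw0 : 0 ≤ ∫ x, window x ^ 2 := integral_nonneg fun _ => sq_nonneg _
  set A := ((2 * Real.pi) ^ 2 * (max C 0) ^ 2) *
    ((∫ x, window x ^ 2) * (∫ x, plateau x ^ 2) ^ 2 * W ^ 2) with hA
  have hA0 : 0 ≤ A := by positivity
  obtain ⟨n, hn⟩ := exists_nat_gt (A / (∫ x, cutoff x) ^ 4)
  have hn0 : (0 : ℝ) < n := lt_of_le_of_lt (by positivity) hn
  rw [div_lt_iff₀ (by positivity)] at hn
  have key := integral_cellSum_le_of_collapsing hε hC hW n
  have hI : 0 < ∫ ξ, cellSum n ξ := by rw [integral_cellSum]; positivity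
  rw [← hA, sq] at key
  have key' := le_of_mul_le_mul_right key hI
  rw [integral_cellSum, mul_comm (n : ℝ), mul_assoc] at key'
  exact hn.not_ge (le_of_mul_le_mul_left key' (by positivity))

end
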